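/- Let F be the standard normal distribution function with density f(x) = (2π)^{-1/2} e^{-x²/2}. With norming constants b_n = √(2 log n) - (log log n + log(4π))/(2√(2 log n)) and a_n = 1/√(2 log n), the density of the normalized maximum is g_n(x) = n a_n f(a_n x + b_n) F^{n-1}(a_n x + b_n). Then lim_{n→∞} H(g_n) = H(λ) = γ + 1, the entropy of the Gumbel law, and lim_{n→∞} D(g_n‖λ) = 0. -/

import Mathlib

open MeasureTheory Real Filter

theorem integral_log_mul_exp_neg :
    ∫ t in Set.Ioi (0 : ℝ), log t * exp (-t) = -eulerMascheroniConstant := by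
  have h1 := Complex.hasDerivAt_GammaIntegral (s := 1) (by simp)
  have h2 : HasDerivAt Complex.GammaIntegral (-(eulerMascheroniConstant : ℂ)) 1 := by
    refine Complex.hasDerivAt_Gamma_one.congr_of_eventuallyEq ?_
    have : ∀ᶠ s : ℂ in nhds 1, 0 < s.re :=
      (isOpen_lt continuous_const Complex.continuous_re).mem_nhds (by simp)
    filter_upwards [this] with s hs using (Complex.Gamma_eq_integral hs).symm
  have h3 := h1.unique h2
  simp only [sub_self, Complex.cpow_zero, one_mul] at h3
  have h4 : ∫ t in Set.Ioi (0 : ℝ), (log t : ℂ) * (exp (-t) : ℂ)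
      = ((∫ t in Set.Ioi (0 : ℝ), log t * exp (-t) : ℝ) : ℂ) := by
    rw [← integral_complex_ofReal]
    simp
  rw [h4] at h3
  exact_mod_cast h3

theorem integral_id_mul_exp_neg : ∫ t in Set.Ioi (0 : ℝ), t * exp (-t) = 1 := by
  have h := integral_rpow_mul_exp_neg_mul_Ioi (a := 2) (r := 1) (by norm_num) (by norm_num)
  norm_num at h
  exact h

theorem integral_gumbel_mul_log :
    ∫ x : ℝ, exp (-x) * exp (-exp (-x)) * log (exp (-x) * exp (-exp (-x)))
      = -(eulerMascheroniConstant + 1) := by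
  have hcv := integral_image_eq_integral_abs_deriv_smul (s := Set.univ)
    (f := fun x : ℝ => exp (-x)) (f' := fun x => -exp (-x)) MeasurableSet.univ
    (fun x _ => by
      have := ((hasDerivAt_id x).neg).exp
      simpa using this)
    (fun x _ y _ h => by simpa using h)
    (fun u => log u * exp (-u) - u * exp (-u))
  have him : (fun x : ℝ => exp (-x)) '' Set.univ = Set.Ioi 0 := by
    rw [Set.image_univ]
    ext y
    simp only [Set.mem_range, Set.mem_Ioi]
    exact ⟨fun ⟨x, hx⟩ => hx ▸ exp_pos _, fun hy => ⟨-log y, by simp [exp_log hy]⟩⟩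
  rw [him, integral_sub] at hcv
  · rw [integral_log_mul_exp_neg, integral_id_mul_exp_neg, setIntegral_univ] at hcv
    rw [neg_add', hcv]
    refine integral_congr_ae (Eventually.of_forall fun x => ?_)
    simp only [abs_neg, abs_exp, smul_eq_mul, log_exp]
    rw [← exp_add (-x), log_exp, exp_add]
    ring
  · by_contra h
    have h0 := integral_undef h
    rw [integral_log_mul_exp_neg] at h0
    linarith [one_half_lt_eulerMascheroniConstant]
  · by_contra h
    have h0 := integral_undef h
    rw [integral_id_mul_exp_neg] at h0
    norm_num at h0

theorem abs_mul_log_le {y : ℝ} (hy : 0 < y) : |y * log y| ≤ 2 * √y + y ^ 2 := by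
  rcases le_total y 1 with h | h
  · have h1 := abs_log_mul_self_rpow_lt y (1 / 2) hy h (by norm_num)
    rw [← sqrt_eq_rpow] at h1
    have h2 : y * log y = √y * (log y * √y) := by
      nth_rw 1 [← mul_self_sqrt hy.le]; ring
    rw [h2, abs_mul, abs_of_nonneg (sqrt_nonneg y)]
    have := mul_le_mul_of_nonneg_left h1.le (sqrt_nonneg y)
    nlinarith [sq_nonneg y]
  · rw [abs_of_nonneg (mul_nonneg hy.le (log_nonneg h))]
    have := log_le_sub_one_of_pos hy
    nlinarith [sqrt_nonneg y]

theorem integrable_exp_neg_mul_abs {c : ℝ} (hc : 0 < c) :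
    Integrable fun x : ℝ => exp (-c * |x|) := by
  rw [← integrableOn_univ, ← Set.Iic_union_Ioi (a := (0 : ℝ)), integrableOn_union]
  constructor
  · refine (integrableOn_exp_mul_Iic hc 0).congr_fun (fun x hx => ?_) measurableSet_Iic
    dsimp only
    rw [abs_of_nonpos hx]; ring_nf
  · refine (integrableOn_exp_mul_Ioi (neg_lt_zero.2 hc) 0).congr_fun (fun x hx => ?_)
      measurableSet_Ioi
    dsimp only
    rw [abs_of_pos hx]

/-- Densities dominated by an exponential bound that converge pointwise to the Gumbel density. -/
theorem tendsto_entropy_of_dominated {G : ℕ → ℝ → ℝ} {K : ℝ}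
    (hm : ∀ n, Measurable (G n)) (hpos : ∀ᶠ n in atTop, ∀ x, 0 < G n x)
    (hK : ∀ᶠ n in atTop, ∀ x, G n x ≤ K * exp (-|x| / 2))
    (hK' : ∀ᶠ n in atTop, ∀ x, G n x * exp (-x) ≤ K * exp (-|x| / 2))
    (hlim : ∀ x, Tendsto (fun n => G n x) atTop (nhds (exp (-x) * exp (-exp (-x))))) :
    Tendsto (fun n => ∫ x, G n x * log (G n x)) atTop (nhds (-(eulerMascheroniConstant + 1))) ∧
    Tendsto (fun n => ∫ x, G n x * log (G n x / (exp (-x) * exp (-exp (-x))))) atTop (nhds 0) := by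
  have hKpos : 0 ≤ K := by
    obtain ⟨n, h1, h2⟩ := (hpos.and hK).exists
    have := (h1 0).trans_le (h2 0)
    simp at this
    exact this.le
  have hlim' (x : ℝ) : Tendsto (fun n => log (G n x)) atTop
      (nhds (log (exp (-x) * exp (-exp (-x))))) :=
    (hlim x).log (by positivity)
  have hE (x : ℝ) : exp (-|x| / 2) = exp (-(1 / 4) * |x|) * exp (-(1 / 4) * |x|) := by
    rw [← exp_add]; ring_nf
  have hE1 (x : ℝ) : exp (-(1 / 4) * |x|) ≤ 1 := by
    rw [exp_le_one_iff]; linarith [abs_nonneg x]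
  have hb {y x : ℝ} (hy : 0 < y) (h : y ≤ K * exp (-|x| / 2)) :
      |y * log y| ≤ (2 * √K + K ^ 2) * exp (-(1 / 4) * |x|) := by
    refine (abs_mul_log_le hy).trans ?_
    rw [hE] at h
    have hp := exp_pos (-(1 / 4) * |x|)
    have h1 := hE1 x
    generalize exp (-(1 / 4) * |x|) = e at *
    have hs : √y ≤ √K * e := by
      rw [← sqrt_mul_self hp.le, ← sqrt_mul hKpos]
      exact sqrt_le_sqrt h
    have he : (e * e) ^ 2 ≤ e := by
      have : e * e ≤ e := by nlinarith
      have h3 : e * e ≤ 1 := this.trans h1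
      nlinarith [mul_pos hp hp]
    have hy2 : y ^ 2 ≤ K ^ 2 * e := by
      calc y ^ 2 ≤ (K * (e * e)) ^ 2 := pow_le_pow_left₀ hy.le h 2
        _ = K ^ 2 * (e * e) ^ 2 := by ring
        _ ≤ K ^ 2 * e := by gcongr
    nlinarith
  have hlog {y x : ℝ} (hy : 0 < y) :
      y * log (y / (exp (-x) * exp (-exp (-x)))) = y * log y + (y * x + y * exp (-x)) := by
    rw [log_div hy.ne' (by positivity), ← exp_add, log_exp]; ring
  constructor
  · rw [← integral_gumbel_mul_log]
    refine tendsto_integral_filter_of_dominated_convergence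
      (fun x => (2 * √K + K ^ 2) * exp (-(1 / 4) * |x|))
      (Eventually.of_forall fun n => ((hm n).mul (hm n).log).aestronglyMeasurable) ?_
      ((integrable_exp_neg_mul_abs (by norm_num)).const_mul _)
      (Eventually.of_forall fun x => (hlim x).mul (hlim' x))
    filter_upwards [hpos, hK] with n h1 h2
    exact Eventually.of_forall fun x => hb (h1 x) (h2 x)
  · have h0 : (0 : ℝ) = ∫ x : ℝ, (exp (-x) * exp (-exp (-x))) *
        log ((exp (-x) * exp (-exp (-x))) / (exp (-x) * exp (-exp (-x)))) := by
      rw [eq_comm, ← integral_zero ℝ ℝ]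
      refine integral_congr_ae (Eventually.of_forall fun x => ?_)
      dsimp only
      rw [div_self (by positivity)]; simp
    rw [h0]
    refine tendsto_integral_filter_of_dominated_convergence
      (fun x => (2 * √K + K ^ 2 + 5 * K) * exp (-(1 / 4) * |x|))
      (Eventually.of_forall fun n => ((hm n).mul ((hm n).div
        (by fun_prop)).log).aestronglyMeasurable) ?_
      ((integrable_exp_neg_mul_abs (by norm_num)).const_mul _)
      (Eventually.of_forall fun x => (hlim x).mul
        (((hlim x).div_const _).log (by positivity)))
    filter_upwards [hpos, hK, hK'] with n h1 h2 h3
    refine Eventually.of_forall fun x => ?_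
    rw [hlog (h1 x), norm_eq_abs]
    have e1 := hb (h1 x) (h2 x)
    have e2 : |G n x * x| ≤ 4 * K * exp (-(1 / 4) * |x|) := by
      rw [abs_mul, abs_of_pos (h1 x)]
      have h4 : |x| * exp (-(1 / 4) * |x|) ≤ 4 := by
        have := add_one_le_exp (1 / 4 * |x|)
        rw [neg_mul, exp_neg, ← div_eq_mul_inv, div_le_iff₀ (exp_pos _)]
        linarith
      calc G n x * |x| ≤ K * exp (-|x| / 2) * |x| := by gcongr; exact h2 x
        _ = K * exp (-(1 / 4) * |x|) * (|x| * exp (-(1 / 4) * |x|)) := by rw [hE]; ring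
        _ ≤ K * exp (-(1 / 4) * |x|) * 4 := by gcongr
        _ = _ := by ring
    have e3 : |G n x * exp (-x)| ≤ K * exp (-(1 / 4) * |x|) := by
      rw [abs_of_pos (mul_pos (h1 x) (exp_pos _))]
      refine (h3 x).trans ?_
      gcongr
      linarith [abs_nonneg x]
    calc _ ≤ |G n x * log (G n x)| + (|G n x * x| + |G n x * exp (-x)|) :=
          (abs_add_le _ _).trans (by gcongr; exact abs_add_le _ _)
      _ ≤ _ := by linarith

theorem exp_quadratic_le {r k e : ℝ} (hr : 3 / 4 ≤ r) (hr' : r ≤ 1) (hk : 0 ≤ k) (he : 0 ≤ e)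
    (t : ℝ) : exp (-r * t - k * t ^ 2 - e) ≤ exp (-1 * t) + exp (-(1 / 2) * t) := by
  have hq : 0 ≤ k * t ^ 2 := by positivity
  rcases le_total t 0 with h | h
  · have : exp (-r * t - k * t ^ 2 - e) ≤ exp (-1 * t) := exp_le_exp.2 (by nlinarith)
    linarith [exp_pos (-(1 / 2) * t)]
  · have : exp (-r * t - k * t ^ 2 - e) ≤ exp (-(1 / 2) * t) := exp_le_exp.2 (by nlinarith)
    linarith [exp_pos (-1 * t)]

theorem integrableOn_exp_bound (x : ℝ) :
    IntegrableOn (fun t : ℝ => exp (-1 * t) + exp (-(1 / 2) * t)) (Set.Ioi x) :=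
  (integrableOn_exp_mul_Ioi (by norm_num) x).add (integrableOn_exp_mul_Ioi (by norm_num) x)

theorem integrableOn_exp_quadratic {r k e : ℝ} (hr : 3 / 4 ≤ r) (hr' : r ≤ 1) (hk : 0 ≤ k)
    (he : 0 ≤ e) (x : ℝ) :
    IntegrableOn (fun t : ℝ => exp (-r * t - k * t ^ 2 - e)) (Set.Ioi x) := by
  refine (integrableOn_exp_bound x).mono' (by fun_prop) (Eventually.of_forall fun t => ?_)
  rw [norm_eq_abs, abs_exp]
  exact exp_quadratic_le hr hr' hk he t

theorem le_integral_exp_quadratic {r k e x : ℝ} (hr : 3 / 4 ≤ r) (hr' : r ≤ 1) (hk : 0 ≤ k)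
    (hk' : k ≤ 1 / 4) (he : 0 ≤ e) (he' : e ≤ 1) (hx : x ≤ 0) (hkx : -x * k ≤ 1 / 2) :
    exp (-x / 4 - 3) ≤ ∫ t in Set.Ioi x, exp (-r * t - k * t ^ 2 - e) := by
  have hi := integrableOn_exp_quadratic hr hr' hk he x
  calc exp (-x / 4 - 3) = ∫ t in Set.Ioc x (x + 1), exp (-x / 4 - 3) := by simp
    _ ≤ ∫ t in Set.Ioc x (x + 1), exp (-r * t - k * t ^ 2 - e) := by
      refine setIntegral_mono_on (by simp) (hi.mono_set Set.Ioc_subset_Ioi_self)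
        measurableSet_Ioc fun t ht => exp_le_exp.2 ?_
      rcases le_total t 0 with h | h
      · have h1 : -t * k ≤ 1 / 2 := by nlinarith [ht.1]
        nlinarith [ht.1, ht.2]
      · have h1 : t ≤ 1 := by linarith [ht.2]
        have h2 : k * t ^ 2 ≤ 1 / 4 := by nlinarith
        nlinarith [ht.1, ht.2]
    _ ≤ _ := setIntegral_mono_set hi (Eventually.of_forall fun _ => (exp_pos _).le)
        (Set.Ioc_subset_Ioi_self.eventuallyLE)

theorem mul_le_exp_add {κ z : ℝ} (hκ : 0 < κ) (hz : 0 ≤ z) :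
    5 * z ≤ κ * exp (z / 4) + 200 / κ := by
  have h := quadratic_le_exp_of_nonneg (x := z / 4) (by positivity)
  have h1 : 5 * z ≤ κ * (z ^ 2 / 32) + 200 / κ := by
    have : κ * (z ^ 2 / 32) + 200 / κ - 5 * z = (κ * z - 80) ^ 2 / (32 * κ) := by
      field_simp; ring
    have : 0 ≤ (κ * z - 80) ^ 2 / (32 * κ) := by positivity
    linarith
  nlinarith

theorem exp_quadratic_mul_pow_le {n : ℕ} (hn : 2 ≤ n) {r L e : ℝ} (hL : 1 ≤ L)
    (hr : 3 / 4 ≤ r) (hr' : r ≤ 1) (he : 0 ≤ e) (he' : e ≤ 1) {Φ x : ℝ} (hΦ : 0 ≤ Φ)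
    (hT : n * (1 - Φ) = ∫ t in Set.Ioi x, exp (-r * t - 1 / (4 * L) * t ^ 2 - e)) :
    let y := exp (-r * x - 1 / (4 * L) * x ^ 2 - e) * Φ ^ (n - 1)
    let K := exp (200 / (exp (-3) / 2))
    y ≤ K * exp (-|x| / 2) ∧ y * exp (-x) ≤ K * exp (-|x| / 2) := by
  intro y K
  have hn' : (2 : ℝ) ≤ n := by exact_mod_cast hn
  have hK : 1 ≤ K := one_le_exp (by positivity)
  have hk : 0 ≤ 1 / (4 * L) := by positivity
  have hk' : 1 / (4 * L) ≤ 1 / 4 := by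
    rw [div_le_div_iff₀ (by positivity) (by norm_num)]; linarith
  set T := ∫ t in Set.Ioi x, exp (-r * t - 1 / (4 * L) * t ^ 2 - e) with hTdef
  have hT0 : 0 ≤ T := setIntegral_nonneg measurableSet_Ioi fun _ _ => (exp_pos _).le
  have hΦ1 : Φ ≤ 1 := by nlinarith
  have hq : 0 ≤ 1 / (4 * L) * x ^ 2 := by positivity
  rcases le_total 0 x with h | h
  · rw [abs_of_nonneg h]
    have h1 : y ≤ exp (-x / 2) := by
      calc y ≤ exp (-r * x - 1 / (4 * L) * x ^ 2 - e) * 1 := by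
            exact mul_le_mul_of_nonneg_left (pow_le_one₀ hΦ hΦ1) (exp_pos _).le
        _ ≤ exp (-x / 2) := by rw [mul_one]; exact exp_le_exp.2 (by nlinarith)
    have h2 : y ≤ K * exp (-x / 2) := by nlinarith [exp_pos (-x / 2)]
    refine ⟨h2, le_trans ?_ h2⟩
    exact mul_le_of_le_one_right (by positivity) (exp_le_one_iff.2 (by linarith))
  · rw [abs_of_nonpos h]
    have hpow : Φ ^ (n - 1) ≤ exp (-(T / 2)) := by
      calc Φ ^ (n - 1) ≤ exp (-(1 - Φ)) ^ (n - 1) := by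
            gcongr; linarith [add_one_le_exp (-(1 - Φ))]
        _ = exp (-((n - 1) * (1 - Φ))) := by
            rw [← exp_nat_mul, Nat.cast_sub (by omega)]; push_cast; ring_nf
        _ ≤ exp (-(T / 2)) := exp_le_exp.2 (by nlinarith)
    have hmain : -x - 1 / (4 * L) * x ^ 2 - T / 2 ≤ 200 / (exp (-3) / 2) + 2 * x := by
      rcases le_total (-(2 * L)) x with hx | hx
      · have h1 := le_integral_exp_quadratic hr hr' hk hk' he he' h
          (by rw [← div_eq_mul_one_div, div_le_iff₀ (by positivity)]; linarith)
        have h2 := mul_le_exp_add (κ := exp (-3) / 2) (z := -x) (by positivity) (by linarith)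
        rw [← hTdef, sub_eq_add_neg, exp_add] at h1
        linarith
      · have h1 := le_integral_exp_quadratic (x := -(2 * L)) hr hr' hk hk' he he' (by linarith)
          (by field_simp; norm_num)
        have h2 := mul_le_exp_add (κ := exp (-3) / 2) (z := 2 * L) (by positivity) (by linarith)
        have h3 : (∫ t in Set.Ioi (-(2 * L)), exp (-r * t - 1 / (4 * L) * t ^ 2 - e)) ≤ T :=
          setIntegral_mono_set (integrableOn_exp_quadratic hr hr' hk he x)
            (Eventually.of_forall fun _ => (exp_pos _).le)
            (Set.Ioi_subset_Ioi hx).eventuallyLE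
        rw [sub_eq_add_neg, exp_add, neg_neg] at h1
        have h4 : -(3 * x) - 1 / (4 * L) * x ^ 2 ≤ 9 * L := by
          have : 9 * L - (-(3 * x) - 1 / (4 * L) * x ^ 2) = (x + 6 * L) ^ 2 / (4 * L) := by
            field_simp; ring
          have : 0 ≤ (x + 6 * L) ^ 2 / (4 * L) := by positivity
          linarith
        linarith
    have hy : y ≤ K * exp (2 * x) := by
      calc y ≤ exp (-x - 1 / (4 * L) * x ^ 2) * exp (-(T / 2)) := by
            refine mul_le_mul (exp_le_exp.2 (by nlinarith)) hpow (by positivity) (by positivity)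
        _ ≤ K * exp (2 * x) := by
            rw [← exp_add, ← exp_add]; exact exp_le_exp.2 (by linarith)
    constructor
    · refine hy.trans ?_
      gcongr
      linarith
    · calc y * exp (-x) ≤ K * exp (2 * x) * exp (-x) := by gcongr
        _ = K * exp x := by rw [mul_assoc, ← exp_add]; ring_nf
        _ ≤ _ := by gcongr; linarith

theorem tendsto_exp_quadratic_mul_pow {r k e : ℕ → ℝ} {Φ : ℕ → ℝ} {x : ℝ}
    (hr : Tendsto r atTop (nhds 1)) (hk : Tendsto k atTop (nhds 0))
    (he : Tendsto e atTop (nhds 0))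
    (hb : ∀ᶠ n in atTop, 3 / 4 ≤ r n ∧ r n ≤ 1 ∧ 0 ≤ k n ∧ 0 ≤ e n)
    (hT : ∀ᶠ n : ℕ in atTop,
      n * (1 - Φ n) = ∫ t in Set.Ioi x, exp (-r n * t - k n * t ^ 2 - e n)) :
    Tendsto (fun n => exp (-r n * x - k n * x ^ 2 - e n) * Φ n ^ (n - 1)) atTop
      (nhds (exp (-x) * exp (-exp (-x)))) := by
  have hh (t : ℝ) : Tendsto (fun n => exp (-r n * t - k n * t ^ 2 - e n)) atTop
      (nhds (exp (-t))) := by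
    have := (((hr.neg.mul_const t).sub (hk.mul_const (t ^ 2))).sub he).rexp
    simpa using this
  have hint : Tendsto (fun n => ∫ t in Set.Ioi x, exp (-r n * t - k n * t ^ 2 - e n)) atTop
      (nhds (exp (-x))) := by
    rw [← integral_exp_neg_Ioi]
    refine tendsto_integral_filter_of_dominated_convergence
      (fun t : ℝ => exp (-1 * t) + exp (-(1 / 2) * t))
      (Eventually.of_forall fun n => by fun_prop) ?_ (integrableOn_exp_bound x)
      (Eventually.of_forall hh)
    filter_upwards [hb] with n h
    refine Eventually.of_forall fun t => ?_
    rw [norm_eq_abs, abs_exp]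
    exact exp_quadratic_le h.1 h.2.1 h.2.2.1 h.2.2.2 t
  have hn : Tendsto (fun n : ℕ => n * (Φ n - 1)) atTop (nhds (-exp (-x))) := by
    refine hint.neg.congr' ?_
    filter_upwards [hT] with n h
    rw [← h]; ring
  have hΦ : Tendsto Φ atTop (nhds 1) := by
    have := (hn.mul tendsto_inv_atTop_nhds_zero_nat).add_const 1
    simp only [mul_zero, zero_add] at this
    refine this.congr' ?_
    filter_upwards [eventually_ne_atTop 0] with n h
    have : (n : ℝ) ≠ 0 := by exact_mod_cast h
    field_simp; ring
  refine (hh x).mul ?_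
  have hp := (tendsto_one_add_pow_exp_of_tendsto hn).div hΦ one_ne_zero
  rw [div_one] at hp
  refine hp.congr' ?_
  filter_upwards [hΦ.eventually_ne one_ne_zero, eventually_ge_atTop 1] with n h h1
  simp only [Pi.div_apply, add_sub_cancel]
  obtain ⟨m, rfl⟩ := Nat.exists_eq_add_of_le' h1
  rw [pow_succ, Nat.add_sub_cancel]
  field_simp

theorem mul_gaussian_comp_affine {n : ℕ} (hn : 2 ≤ n) {s c : ℝ} (hs : s = √(2 * log n))
    (hc : c = log (log n) + log (4 * π)) (x : ℝ) :
    n * (1 / s) * (exp (-((1 / s) * x + (s - c / (2 * s))) ^ 2 / 2) / √(2 * π))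
      = exp (-(1 - c / (4 * log n)) * x - 1 / (4 * log n) * x ^ 2 - c ^ 2 / (16 * log n)) := by
  have hL : 0 < log n := log_pos (by exact_mod_cast hn)
  have hn0 : (n : ℝ) = exp (log n) := (exp_log (by positivity)).symm
  have hspos : 0 < s := by rw [hs]; positivity
  have hs2 : s ^ 2 = 2 * log n := by rw [hs, sq_sqrt (by positivity)]
  have hprod : (1 / s) * (1 / √(2 * π)) = exp (-(c / 2)) := by
    have h1 : s * √(2 * π) = exp (c / 2) := by
      rw [hs, ← sqrt_mul (by positivity), hc, ← log_mul (by positivity) (by positivity), exp_half,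
        exp_log (by positivity)]
      ring_nf
    rw [exp_neg, ← h1]; field_simp
  have hLs : log n = s ^ 2 / 2 := by rw [hs2]; ring
  calc _ = n * ((1 / s) * (1 / √(2 * π)))
        * exp (-((1 / s) * x + (s - c / (2 * s))) ^ 2 / 2) := by ring
    _ = exp (log n + -(c / 2) + -((1 / s) * x + (s - c / (2 * s))) ^ 2 / 2) := by
      rw [hprod, exp_add, exp_add, ← hn0]
    _ = _ := by
      rw [hLs]
      congr 1
      field_simp
      ring

theorem tendsto_norming_correction {c : ℕ → ℝ}
    (hc : ∀ n : ℕ, c n = log (log n) + log (4 * π)) :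
    Tendsto (fun n : ℕ => c n / (4 * log n)) atTop (nhds 0) ∧
    Tendsto (fun n : ℕ => c n ^ 2 / (16 * log n)) atTop (nhds 0) ∧
    ∀ᶠ n in atTop, 0 ≤ c n := by
  have hL : Tendsto (fun n : ℕ => log n) atTop atTop :=
    tendsto_log_atTop.comp tendsto_natCast_atTop_atTop
  have hs : Tendsto (fun n : ℕ => √(log n)) atTop atTop := tendsto_sqrt_atTop.comp hL
  have h1 : Tendsto (fun n : ℕ => c n / √(log n)) atTop (nhds 0) := by
    have h := ((isLittleO_log_rpow_atTop (r := 1 / 2) (by norm_num)).tendsto_div_nhds_zero.comp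
      hL).add (hs.const_div_atTop (log (4 * π)))
    simp only [← sqrt_eq_rpow, add_zero] at h
    refine h.congr fun n => ?_
    rw [hc, add_div]; rfl
  have hpos := hL.eventually_gt_atTop 0
  refine ⟨?_, ?_, ?_⟩
  · have h := (h1.mul hs.inv_tendsto_atTop).div_const 4
    simp only [mul_zero, zero_div] at h
    refine h.congr' ?_
    filter_upwards [hpos] with n hn
    have : √(log n) * √(log n) = log n := mul_self_sqrt hn.le
    simp only [Pi.inv_apply]
    rw [← div_eq_mul_inv, div_div, div_div, ← mul_assoc, this, mul_comm]
  · have h := (h1.pow 2).div_const 16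
    simp only [ne_eq, OfNat.ofNat_ne_zero, not_false_eq_true, zero_pow, zero_div] at h
    refine h.congr' ?_
    filter_upwards [hpos] with n hn
    rw [div_pow, sq_sqrt hn.le, div_div, mul_comm]
  · filter_upwards [hL.eventually_ge_atTop 1] with n hn
    rw [hc]
    have : 1 ≤ 4 * π := by linarith [pi_gt_three]
    exact add_nonneg (log_nonneg hn) (log_nonneg this)

theorem integral_Ioi_comp_affine (f : ℝ → ℝ) {a : ℝ} (ha : 0 < a) (b x : ℝ) :
    ∫ t in Set.Ioi x, a * f (a * t + b) = ∫ t in Set.Ioi (a * x + b), f t := by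
  have h := integral_image_eq_integral_abs_deriv_smul (s := Set.Ioi x)
    (f := fun t : ℝ => a * t + b) (f' := fun _ => a) measurableSet_Ioi
    (fun t _ => by simpa using (((hasDerivAt_id t).const_mul a).add_const b).hasDerivWithinAt)
    (fun t _ u _ h => by simpa [ha.ne'] using h) f
  have him : (fun t : ℝ => a * t + b) '' Set.Ioi x = Set.Ioi (a * x + b) := by
    ext y
    constructor
    · rintro ⟨t, ht, rfl⟩
      have := mul_lt_mul_of_pos_left (show x < t from ht) ha
      simpa using this
    · intro hy
      refine ⟨(y - b) / a, ?_, by field_simp; ring⟩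
      rw [Set.mem_Ioi, lt_div_iff₀ ha]
      rw [Set.mem_Ioi] at hy
      linarith
  rw [him] at h
  rw [h]
  simp [abs_of_pos ha]

/-- For the standard normal distribution function `F` with density
`f x = (2π)^(-1/2) * exp (-x²/2)`, and norming constants
`b_n = √(2 log n) - (log log n + log (4π)) / (2 √(2 log n))`, `a_n = 1/√(2 log n)`,
the density of the normalized maximum is
`g_n x = n * a_n * f (a_n x + b_n) * F (a_n x + b_n)^(n-1)`. Then
`H (g n) → H(λ) = γ + 1`, the entropy of the Gumbel law, and `D (g n ‖ λ) → 0`. -/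
theorem entropy_max_normal
    (f F : ℝ → ℝ)
    (hf : ∀ x, f x = Real.exp (-x ^ 2 / 2) / Real.sqrt (2 * Real.pi))
    (hF : ∀ x, F x = ∫ t in Set.Iic x, f t)
    (a b : ℕ → ℝ)
    (ha : ∀ n, a n = 1 / Real.sqrt (2 * Real.log n))
    (hb : ∀ n, b n = Real.sqrt (2 * Real.log n) -
      (Real.log (Real.log n) + Real.log (4 * Real.pi)) /
        (2 * Real.sqrt (2 * Real.log n)))
    (g : ℕ → ℝ → ℝ)
    (hg : ∀ n x, g n x = n * a n * f (a n * x + b n) * F (a n * x + b n) ^ (n - 1))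
    (lam : ℝ → ℝ)
    (hlam : ∀ x, lam x = Real.exp (-x) * Real.exp (-Real.exp (-x)))
    (H : (ℝ → ℝ) → ℝ)
    (hH : ∀ p, H p = -∫ x in {x | 0 < p x}, p x * Real.log (p x))
    (D : (ℝ → ℝ) → (ℝ → ℝ) → ℝ)
    (hD : ∀ p q, D p q = ∫ x in {x | 0 < p x}, p x * Real.log (p x / q x)) :
    Tendsto (fun n => H (g n)) atTop
      (nhds (Real.eulerMascheroniConstant + 1)) ∧
    Tendsto (fun n => D (g n) lam) atTop (nhds 0) := by
  have hfpdf : f = ProbabilityTheory.gaussianPDFReal 0 1 := by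
    ext x
    simp [hf, ProbabilityTheory.gaussianPDFReal_def, div_eq_inv_mul]
  have hfi : Integrable f := hfpdf ▸ ProbabilityTheory.integrable_gaussianPDFReal 0 1
  have hf1 : ∫ x, f x = 1 :=
    hfpdf ▸ ProbabilityTheory.integral_gaussianPDFReal_eq_one 0 one_ne_zero
  have hfpos (x : ℝ) : 0 < f x := by rw [hf]; positivity
  have hfm : Measurable f := hfpdf ▸ ProbabilityTheory.measurable_gaussianPDFReal 0 1
  have hFpos (x : ℝ) : 0 < F x := by
    rw [hF, integral_pos_iff_support_of_nonneg (fun t => (hfpos t).le) hfi.integrableOn]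
    have : Function.support f = Set.univ := by
      ext t; simp [(hfpos t).ne']
    simp [this]
  have hFtail (x : ℝ) : 1 - F x = ∫ t in Set.Ioi x, f t := by
    rw [hF, ← hf1, ← intervalIntegral.integral_Iic_add_Ioi hfi.integrableOn hfi.integrableOn]
    ring
  have hFm : Measurable F := by
    refine Monotone.measurable fun x y hxy => ?_
    rw [hF, hF]
    exact setIntegral_mono_set hfi.integrableOn (Eventually.of_forall fun t => (hfpos t).le)
      (Set.Iic_subset_Iic.2 hxy).eventuallyLE
  set c : ℕ → ℝ := fun n => log (log n) + log (4 * π)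
  obtain ⟨hr0, he0, hc0⟩ := tendsto_norming_correction (c := c) fun _ => rfl
  have hL : Tendsto (fun n : ℕ => log n) atTop atTop :=
    tendsto_log_atTop.comp tendsto_natCast_atTop_atTop
  have hk0 : Tendsto (fun n : ℕ => 1 / (4 * log n)) atTop (nhds 0) :=
    (hL.const_mul_atTop (by norm_num)).const_div_atTop 1
  have hr : Tendsto (fun n : ℕ => 1 - c n / (4 * log n)) atTop (nhds 1) := by
    simpa using hr0.const_sub 1
  have hh : ∀ᶠ n : ℕ in atTop, ∀ x, n * a n * f (a n * x + b n) =
      exp (-(1 - c n / (4 * log n)) * x - 1 / (4 * log n) * x ^ 2 - c n ^ 2 / (16 * log n)) := by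
    filter_upwards [eventually_ge_atTop 2] with n hn x
    rw [← mul_gaussian_comp_affine hn rfl rfl x, hf, ha, hb]
  have hgood : ∀ᶠ n : ℕ in atTop, 2 ≤ n ∧ 1 ≤ log n ∧ 3 / 4 ≤ 1 - c n / (4 * log n) ∧
      1 - c n / (4 * log n) ≤ 1 ∧ 0 ≤ c n ^ 2 / (16 * log n) ∧ c n ^ 2 / (16 * log n) ≤ 1 := by
    filter_upwards [eventually_ge_atTop 2, hL.eventually_ge_atTop 1, hc0,
      hr0.eventually_le_const (show (0 : ℝ) < 1 / 4 by norm_num),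
      he0.eventually_le_const one_pos] with n h1 h2 h3 h4 h5
    have : 0 ≤ c n / (4 * log n) := by positivity
    exact ⟨h1, h2, by linarith, by linarith, by positivity, h5⟩
  have hT : ∀ᶠ n : ℕ in atTop, ∀ x, n * (1 - F (a n * x + b n)) = ∫ t in Set.Ioi x,
      exp (-(1 - c n / (4 * log n)) * t - 1 / (4 * log n) * t ^ 2 - c n ^ 2 / (16 * log n)) := by
    filter_upwards [hh, hgood] with n h h' x
    have hapos : 0 < a n := by
      have := h'.2.1
      rw [ha]; positivity
    rw [hFtail, ← integral_Ioi_comp_affine f hapos, ← integral_const_mul]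
    simp_rw [← h, mul_assoc]
  have hgpos : ∀ᶠ n in atTop, ∀ x, 0 < g n x := by
    filter_upwards [hh] with n h x
    rw [hg, h]
    exact mul_pos (exp_pos _) (pow_pos (hFpos _) _)
  have hbound : ∀ᶠ n in atTop, ∀ x,
      g n x ≤ exp (200 / (exp (-3) / 2)) * exp (-|x| / 2) ∧
      g n x * exp (-x) ≤ exp (200 / (exp (-3) / 2)) * exp (-|x| / 2) := by
    filter_upwards [hh, hgood, hT] with n h ⟨h1, h2, h3, h4, h5, h6⟩ h' x
    rw [hg, h]
    exact exp_quadratic_mul_pow_le h1 h2 h3 h4 h5 h6 (hFpos _).le (h' x)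
  have hlim (x : ℝ) : Tendsto (fun n => g n x) atTop (nhds (exp (-x) * exp (-exp (-x)))) := by
    refine (tendsto_exp_quadratic_mul_pow (Φ := fun n => F (a n * x + b n)) hr hk0 he0 ?_
      (hT.mono fun n h => h x)).congr' ?_
    · filter_upwards [hgood] with n ⟨h1, h2, h3, h4, h5, h6⟩
      exact ⟨h3, h4, by positivity, h5⟩
    · filter_upwards [hh] with n h
      rw [hg, h]
  have hgm (n : ℕ) : Measurable (g n) := by
    rw [funext (hg n)]
    fun_prop
  obtain ⟨hent, hrel⟩ := tendsto_entropy_of_dominated hgm hgpos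
    (hbound.mono fun n h x => (h x).1) (hbound.mono fun n h x => (h x).2) hlim
  have huniv : ∀ᶠ n in atTop, {x | 0 < g n x} = Set.univ :=
    hgpos.mono fun n h => Set.eq_univ_of_forall h
  constructor
  · have h := hent.neg
    rw [neg_neg] at h
    refine h.congr' ?_
    filter_upwards [huniv] with n hn
    rw [hH, hn, setIntegral_univ]
  · refine hrel.congr' ?_
    filter_upwards [huniv] with n hn
    simp_rw [hD, hn, setIntegral_univ, hlam]
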